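/- arXiv:2305.19562 — 6 statements merged into one kernel-verified Lean document; each statement's English description precedes it below -/
import Mathlib

section
/- Let m ≥ 1 be an integer and let a_0, a_1, …, a_m ∈ [0,1]. Define Acc : (0,1) → ℝ by Acc(p) = Σ_{k=0}^m a_k · C(m,k) · p^k (1-p)^{m-k}, where C(m,k) is the binomial coefficient. Then Acc is differentiable at every p ∈ (0,1), and its derivative satisfies Acc'(p) ≤ √(m / (p(1-p))). -/
open Finset

/-- The derivative of a binomial weight is the weight times its score. -/
lemma hasDerivAt_binomial_weight {m k : ℕ} (hk : k ≤ m) (c : ℝ) {p : ℝ}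
    (hp : p ∈ Set.Ioo (0 : ℝ) 1) :
    HasDerivAt (fun x : ℝ => c * x ^ k * (1 - x) ^ (m - k))
      (c * p ^ k * (1 - p) ^ (m - k) * ((k - m * p) / (p * (1 - p)))) p := by
  obtain ⟨j, rfl⟩ := Nat.exists_eq_add_of_le hk
  have hp0 : p ≠ 0 := hp.1.ne'
  have hq0 : 1 - p ≠ 0 := (sub_pos.2 hp.2).ne'
  rw [Nat.add_sub_cancel_left]
  have h := ((hasDerivAt_pow k p).const_mul c).mul (((hasDerivAt_id p).const_sub 1).pow j)
  refine h.congr_deriv ?_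
  cases k <;> cases j <;> simp <;> field_simp <;> ring

lemma sum_binomial_weight (m : ℕ) (p : ℝ) :
    ∑ k ∈ range (m + 1), (m.choose k : ℝ) * p ^ k * (1 - p) ^ (m - k) = 1 := by
  simpa [bernsteinPolynomial, Polynomial.eval_finsetSum] using
    congrArg (Polynomial.eval p) (bernsteinPolynomial.sum ℝ m)

lemma sum_sq_mul_binomial_weight (m : ℕ) (p : ℝ) :
    ∑ k ∈ range (m + 1), (m * p - k) ^ 2 * ((m.choose k : ℝ) * p ^ k * (1 - p) ^ (m - k)) =
      m * p * (1 - p) := by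
  simpa [bernsteinPolynomial, Polynomial.eval_finsetSum] using
    congrArg (Polynomial.eval p) (bernsteinPolynomial.variance ℝ m)

/-- For `m ≥ 1` and coefficients `a_0, …, a_m ∈ [0,1]`, the polynomial
`Acc p = ∑_{k=0}^m a_k C(m,k) p^k (1-p)^{m-k}` is differentiable at every `p ∈ (0,1)`
and its derivative is at most `√(m / (p (1-p)))`. -/
theorem stmt_0 (m : ℕ) (hm : 1 ≤ m) (a : ℕ → ℝ) (ha : ∀ k ≤ m, a k ∈ Set.Icc (0 : ℝ) 1)
    (Acc : ℝ → ℝ)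
    (hAcc : ∀ p : ℝ, Acc p =
      ∑ k ∈ Finset.range (m + 1), a k * (m.choose k : ℝ) * p ^ k * (1 - p) ^ (m - k))
    (p : ℝ) (hp : p ∈ Set.Ioo (0 : ℝ) 1) :
    DifferentiableAt ℝ Acc p ∧ deriv Acc p ≤ Real.sqrt ((m : ℝ) / (p * (1 - p))) := by
  have hp0 : 0 < p := hp.1
  have hq0 : 0 < 1 - p := sub_pos.2 hp.2
  have hder : HasDerivAt Acc (∑ k ∈ range (m + 1), a k * (m.choose k : ℝ) * p ^ k *
      (1 - p) ^ (m - k) * ((k - m * p) / (p * (1 - p)))) p := by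
    rw [funext hAcc]
    exact HasDerivAt.fun_sum fun k hk =>
      hasDerivAt_binomial_weight (Nat.lt_succ_iff.1 (mem_range.1 hk)) _ hp
  refine ⟨hder.differentiableAt, ?_⟩
  rw [hder.deriv]
  apply Real.le_sqrt_of_sq_le
  have hw : ∀ k, 0 ≤ (m.choose k : ℝ) * p ^ k * (1 - p) ^ (m - k) := fun k => by positivity
  calc
    _ ≤ (∑ k ∈ range (m + 1), (m.choose k : ℝ) * p ^ k * (1 - p) ^ (m - k)) *
        ∑ k ∈ range (m + 1), (a k * ((k - m * p) / (p * (1 - p)))) ^ 2 *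
          ((m.choose k : ℝ) * p ^ k * (1 - p) ^ (m - k)) :=
      sum_sq_le_sum_mul_sum_of_sq_le_mul _ (fun k _ => hw k)
        (fun k _ => mul_nonneg (sq_nonneg _) (hw k)) fun k _ => le_of_eq (by ring)
    _ ≤ ∑ k ∈ range (m + 1), ((m * p - k) ^ 2 *
          ((m.choose k : ℝ) * p ^ k * (1 - p) ^ (m - k))) / (p * (1 - p)) ^ 2 := by
      rw [sum_binomial_weight, one_mul]
      refine sum_le_sum fun k hk => ?_
      obtain ⟨h0, h1⟩ := ha k (Nat.lt_succ_iff.1 (mem_range.1 hk))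
      rw [mul_pow, mul_div_right_comm, div_pow, sub_sq_comm (k : ℝ)]
      exact mul_le_mul_of_nonneg_right
        (mul_le_of_le_one_left (by positivity) (pow_le_one₀ h0 h1)) (hw k)
    _ = m / (p * (1 - p)) := by
      rw [← sum_div, sum_sq_mul_binomial_weight]
      field_simp
end

section
/- Let a < b be real numbers, L > 0, and let f : ℝ → ℝ satisfy |f(p) - f(p')| ≤ L|p - p'| for all p, p' ∈ [a,b]. Suppose f(a) ≤ 1/4 and f(b) ≥ 3/4. Then there exist c, d with a ≤ c < d ≤ b, d - c = 1/(3L), and f(p) ∈ [1/3, 2/3] for every p ∈ [c, d]. -/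
/-- A Lipschitz function on `[a,b]` going from `≤ 1/4` at `a` to `≥ 3/4` at `b`
stays in `[1/3, 2/3]` on a subinterval of length `1/(3L)`. -/
theorem stmt_1 (a b L : ℝ) (hab : a < b) (hL : 0 < L) (f : ℝ → ℝ)
    (hf : ∀ p ∈ Set.Icc a b, ∀ p' ∈ Set.Icc a b, |f p - f p'| ≤ L * |p - p'|)
    (hfa : f a ≤ 1 / 4) (hfb : 3 / 4 ≤ f b) :
    ∃ c d : ℝ, a ≤ c ∧ c < d ∧ d ≤ b ∧ d - c = 1 / (3 * L) ∧
      ∀ p ∈ Set.Icc c d, f p ∈ Set.Icc (1 / 3 : ℝ) (2 / 3) := by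
  have hcont : ContinuousOn f (Set.Icc a b) := by
    refine (LipschitzOnWith.of_dist_le_mul (K := ⟨L, hL.le⟩) fun x hx y hy => ?_).continuousOn
    exact hf x hx y hy
  obtain ⟨q, hq, hfq⟩ : (1 / 2 : ℝ) ∈ f '' Set.Icc a b :=
    intermediate_value_Icc hab.le hcont ⟨by linarith, by linarith⟩
  obtain ⟨r, hr⟩ : ∃ r, r = 1 / (6 * L) := ⟨_, rfl⟩
  have hr0 : 0 < r := by rw [hr]; positivity
  have hLr : L * r = 1 / 6 := by rw [hr]; field_simp
  have hqa : a ≤ q - r := by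
    have h := (le_abs_self _).trans (hf q hq a ⟨le_rfl, hab.le⟩)
    rw [abs_of_nonneg (sub_nonneg.2 hq.1)] at h
    have : r ≤ q - a := le_of_mul_le_mul_left (by linarith) hL
    linarith
  have hqb : q + r ≤ b := by
    have h := (le_abs_self _).trans (hf b ⟨hab.le, le_rfl⟩ q hq)
    rw [abs_of_nonneg (sub_nonneg.2 hq.2)] at h
    have : r ≤ b - q := le_of_mul_le_mul_left (by linarith) hL
    linarith
  refine ⟨q - r, q + r, hqa, by linarith, hqb, by rw [hr]; field_simp; norm_num, ?_⟩
  intro p hp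
  have h := hf p ⟨hqa.trans hp.1, hp.2.trans hqb⟩ q hq
  have hpq : |p - q| ≤ r := abs_le.2 ⟨by linarith [hp.1], by linarith [hp.2]⟩
  have hbound := abs_le.1 (h.trans (mul_le_mul_of_nonneg_left hpq hL.le))
  constructor <;> linarith [hbound.1, hbound.2]
end

section
/- Let q ∈ (1/2, 1), ε ∈ (0, q - 1/2), and let m ≥ 1 be an integer. Let g : {0,1}^m → {0,1} satisfy: (i) P_{x ~ Ber(q-ε)^m}[g(x) = 0] ≥ 3/4, and (ii) P_{x ~ Ber(q)^m}[g(x) = 1] ≥ 3/4. Then, if p ~ Uniform[q-ε, q] and, conditionally on p, x and x' are two independent samples from Ber(p)^m, one has P[g(x) ≠ g(x')] ≥ (4/27) · √(q(1-q)/m) / ε. -/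
open MeasureTheory

/-- The Bernoulli measure on `Bool` with probability `p` of `true`. -/
noncomputable def bern (p : ℝ) : Measure Bool :=
  ENNReal.ofReal p • Measure.dirac true + ENNReal.ofReal (1 - p) • Measure.dirac false

/-- The law of `m` i.i.d. `Ber(p)` coin flips: the product measure `Ber(p)^m`. -/
noncomputable def coinSeq (m : ℕ) (p : ℝ) : Measure (Fin m → Bool) :=
  Measure.pi fun _ => bern p

/-- The uniform probability measure on the interval `[a, b]`. -/
noncomputable def unifIcc (a b : ℝ) : Measure ℝ :=
  (ENNReal.ofReal (b - a))⁻¹ • volume.restrict (Set.Icc a b)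

/-- The mass that `Ber(p)` gives to the outcome `b`. -/
def bernWeight (p : ℝ) (b : Bool) : ℝ := cond b p (1 - p)

/-- The score `∂ₚ log (bernWeight p b)` of a single coin flip. -/
noncomputable def bernScore (p : ℝ) (b : Bool) : ℝ := cond b p⁻¹ (-(1 - p)⁻¹)

/-- The mass that `Ber(p)^m` gives to the outcome `x`. -/
def coinWeight {m : ℕ} (p : ℝ) (x : Fin m → Bool) : ℝ := ∏ i, bernWeight p (x i)

/-- The score `∂ₚ log (coinWeight p x)` of `m` coin flips. -/
noncomputable def coinScore {m : ℕ} (p : ℝ) (x : Fin m → Bool) : ℝ := ∑ i, bernScore p (x i)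

/-- The probability, as a polynomial in `p`, that `g` outputs `true` on a sample of `Ber(p)^m`. -/
def acceptProb {m : ℕ} (g : (Fin m → Bool) → Bool) (p : ℝ) : ℝ :=
  ∑ x with g x = true, coinWeight p x

lemma isProbabilityMeasure_bern {p : ℝ} (hp : p ∈ Set.Icc (0 : ℝ) 1) :
    IsProbabilityMeasure (bern p) := by
  constructor
  simp only [bern, Measure.add_apply, Measure.smul_apply, measure_univ, smul_eq_mul, mul_one]
  rw [← ENNReal.ofReal_add hp.1 (by linarith [hp.2])]
  simp

lemma isProbabilityMeasure_coinSeq (m : ℕ) {p : ℝ} (hp : p ∈ Set.Icc (0 : ℝ) 1) :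
    IsProbabilityMeasure (coinSeq m p) := by
  have := isProbabilityMeasure_bern hp
  unfold coinSeq
  infer_instance

lemma bernWeight_nonneg {p : ℝ} (hp : p ∈ Set.Icc (0 : ℝ) 1) (b : Bool) :
    0 ≤ bernWeight p b := by
  cases b
  · simpa [bernWeight] using hp.2
  · simpa [bernWeight] using hp.1

lemma coinWeight_nonneg {m : ℕ} {p : ℝ} (hp : p ∈ Set.Icc (0 : ℝ) 1) (x : Fin m → Bool) :
    0 ≤ coinWeight p x :=
  Finset.prod_nonneg fun _ _ => bernWeight_nonneg hp _

lemma coinSeq_real_singleton {m : ℕ} {p : ℝ} (hp : p ∈ Set.Icc (0 : ℝ) 1) (x : Fin m → Bool) :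
    (coinSeq m p).real {x} = coinWeight p x := by
  have := isProbabilityMeasure_bern hp
  rw [Measure.real, coinSeq, Measure.pi_singleton, ENNReal.toReal_prod]
  refine Finset.prod_congr rfl fun i _ => ?_
  cases x i
  · simp [bern, bernWeight, hp.2]
  · simp [bern, bernWeight, hp.1]

lemma coinSeq_real_accept {m : ℕ} (g : (Fin m → Bool) → Bool) {p : ℝ}
    (hp : p ∈ Set.Icc (0 : ℝ) 1) :
    (coinSeq m p).real {x | g x = true} = acceptProb g p := by
  have := isProbabilityMeasure_coinSeq m hp
  have h := sum_measureReal_singleton (μ := coinSeq m p) (Finset.univ.filter fun x => g x = true)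
  rw [Finset.coe_filter_univ] at h
  rw [← h, acceptProb]
  exact Finset.sum_congr rfl fun x _ => coinSeq_real_singleton hp x

lemma coinSeq_real_reject {m : ℕ} (g : (Fin m → Bool) → Bool) {p : ℝ}
    (hp : p ∈ Set.Icc (0 : ℝ) 1) :
    (coinSeq m p).real {x | g x = false} = 1 - acceptProb g p := by
  have := isProbabilityMeasure_coinSeq m hp
  rw [← coinSeq_real_accept g hp, ← probReal_compl_eq_one_sub (Set.toFinite _).measurableSet]
  congr 1
  ext x
  simp

lemma acceptProb_mem_Icc {m : ℕ} (g : (Fin m → Bool) → Bool) {p : ℝ}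
    (hp : p ∈ Set.Icc (0 : ℝ) 1) : acceptProb g p ∈ Set.Icc (0 : ℝ) 1 := by
  have := isProbabilityMeasure_coinSeq m hp
  rw [← coinSeq_real_accept g hp]
  exact ⟨measureReal_nonneg, measureReal_le_one⟩

lemma coinSeq_prod_real_disagree {m : ℕ} (g : (Fin m → Bool) → Bool) {p : ℝ}
    (hp : p ∈ Set.Icc (0 : ℝ) 1) :
    ((coinSeq m p).prod (coinSeq m p)).real {xx | g xx.1 ≠ g xx.2} =
      2 * acceptProb g p * (1 - acceptProb g p) := by
  have := isProbabilityMeasure_coinSeq m hp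
  have hset : {xx : (Fin m → Bool) × (Fin m → Bool) | g xx.1 ≠ g xx.2} =
      {x | g x = true} ×ˢ {x | g x = false} ∪ {x | g x = false} ×ˢ {x | g x = true} := by
    ext ⟨x, y⟩
    cases hx : g x <;> cases hy : g y <;> simp [hx, hy]
  rw [hset, measureReal_union _ (Set.toFinite _).measurableSet, measureReal_prod_prod,
    measureReal_prod_prod, coinSeq_real_accept g hp, coinSeq_real_reject g hp]
  · ring
  · rw [Set.disjoint_left]
    rintro ⟨x, y⟩ h h'
    simp_all

lemma hasDerivAt_bernWeight {p : ℝ} (hp : p ∈ Set.Ioo (0 : ℝ) 1) (b : Bool) :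
    HasDerivAt (fun t => bernWeight t b) (bernWeight p b * bernScore p b) p := by
  have h0 : p ≠ 0 := hp.1.ne'
  have h1 : 1 - p ≠ 0 := (sub_pos.2 hp.2).ne'
  cases b
  · simpa [bernWeight, bernScore, h1] using (hasDerivAt_id p).const_sub 1
  · simpa [bernWeight, bernScore, h0] using hasDerivAt_id' p

lemma hasDerivAt_coinWeight {m : ℕ} {p : ℝ} (hp : p ∈ Set.Ioo (0 : ℝ) 1) (x : Fin m → Bool) :
    HasDerivAt (fun t => coinWeight t x) (coinWeight p x * coinScore p x) p := by
  have h := HasDerivAt.fun_finsetProd (u := Finset.univ)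
    fun (i : Fin m) _ => hasDerivAt_bernWeight hp (x i)
  refine h.congr_deriv ?_
  rw [coinScore, Finset.mul_sum]
  refine Finset.sum_congr rfl fun i hi => ?_
  rw [coinWeight, ← Finset.prod_erase_mul _ _ hi, smul_eq_mul, mul_assoc]

lemma hasDerivAt_acceptProb {m : ℕ} (g : (Fin m → Bool) → Bool) {p : ℝ}
    (hp : p ∈ Set.Ioo (0 : ℝ) 1) :
    HasDerivAt (acceptProb g) (∑ x with g x = true, coinWeight p x * coinScore p x) p :=
  HasDerivAt.fun_sum fun x _ => hasDerivAt_coinWeight hp x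

/-- The total mass, the mean of the score, and the Fisher information of `Ber(p)^m`. -/
lemma coinScore_moments (m : ℕ) {p : ℝ} (hp : p ∈ Set.Ioo (0 : ℝ) 1) :
    ∑ x : Fin m → Bool, coinWeight p x = 1 ∧
      ∑ x : Fin m → Bool, coinWeight p x * coinScore p x = 0 ∧
      ∑ x : Fin m → Bool, coinWeight p x * coinScore p x ^ 2 = m / (p * (1 - p)) := by
  have hp0 : p ≠ 0 := hp.1.ne'
  have hp1 : 1 - p ≠ 0 := (sub_pos.2 hp.2).ne'
  induction m with
  | zero => simp [coinWeight, coinScore]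
  | succ m ih =>
    obtain ⟨i0, i1, i2⟩ := ih
    have hsum (F : (Fin (m + 1) → Bool) → ℝ) : ∑ x, F x =
        ∑ y : Fin m → Bool, F (Fin.cons true y) + ∑ y : Fin m → Bool, F (Fin.cons false y) := by
      rw [← (Fin.consEquiv fun _ => Bool).sum_comp, Fintype.sum_prod_type, Fintype.sum_bool]
      rfl
    have hw (b : Bool) (y : Fin m → Bool) :
        coinWeight p (Fin.cons b y : Fin (m + 1) → Bool) = bernWeight p b * coinWeight p y := by
      simp [coinWeight, Fin.prod_univ_succ]
    have hs (b : Bool) (y : Fin m → Bool) :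
        coinScore p (Fin.cons b y : Fin (m + 1) → Bool) = bernScore p b + coinScore p y := by
      simp [coinScore, Fin.sum_univ_succ]
    have e0 (b : Bool) : ∑ y : Fin m → Bool, bernWeight p b * coinWeight p y = bernWeight p b := by
      rw [← Finset.mul_sum, i0, mul_one]
    have e1 (b : Bool) : ∑ y : Fin m → Bool,
        bernWeight p b * coinWeight p y * (bernScore p b + coinScore p y) =
          bernWeight p b * bernScore p b := by
      calc _ = bernWeight p b * bernScore p b * ∑ y : Fin m → Bool, coinWeight p y +
            bernWeight p b * ∑ y : Fin m → Bool, coinWeight p y * coinScore p y := by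
            rw [Finset.mul_sum, Finset.mul_sum, ← Finset.sum_add_distrib]
            exact Finset.sum_congr rfl fun y _ => by ring
        _ = _ := by rw [i0, i1]; ring
    have e2 (b : Bool) : ∑ y : Fin m → Bool,
        bernWeight p b * coinWeight p y * (bernScore p b + coinScore p y) ^ 2 =
          bernWeight p b * (bernScore p b ^ 2 + m / (p * (1 - p))) := by
      calc _ = bernWeight p b * bernScore p b ^ 2 * ∑ y : Fin m → Bool, coinWeight p y +
            2 * bernWeight p b * bernScore p b *
              ∑ y : Fin m → Bool, coinWeight p y * coinScore p y +
            bernWeight p b * ∑ y : Fin m → Bool, coinWeight p y * coinScore p y ^ 2 := by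
            rw [Finset.mul_sum, Finset.mul_sum, Finset.mul_sum, ← Finset.sum_add_distrib,
              ← Finset.sum_add_distrib]
            exact Finset.sum_congr rfl fun y _ => by ring
        _ = _ := by rw [i0, i1, i2]; ring
    simp only [hsum, hw, hs, e0, e1, e2]
    refine ⟨by simp [bernWeight], by simp [bernWeight, bernScore, hp0, hp1], ?_⟩
    simp only [bernWeight, bernScore, cond_true, cond_false]
    push_cast
    field_simp
    ring

lemma deriv_acceptProb_le {m : ℕ} (hm : 1 ≤ m) (g : (Fin m → Bool) → Bool) {p : ℝ}
    (hp : p ∈ Set.Ioo (0 : ℝ) 1) :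
    ∑ x with g x = true, coinWeight p x * coinScore p x ≤ √(m / (p * (1 - p))) / 2 := by
  obtain ⟨h0, h1, h2⟩ := coinScore_moments m hp
  have hpos : (0 : ℝ) < m / (p * (1 - p)) :=
    div_pos (by exact_mod_cast hm) (mul_pos hp.1 (sub_pos.2 hp.2))
  set v : ℝ := m / (p * (1 - p))
  set c := √v
  have hc : 0 < c := Real.sqrt_pos.2 hpos
  have hcv : v = c ^ 2 := (Real.sq_sqrt hpos.le).symm
  have hterm (x : Fin m → Bool) :
      (if g x = true then coinWeight p x * coinScore p x else 0) ≤
        coinWeight p x * coinScore p x / 2 +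
          (c / 4 * coinWeight p x + (4 * c)⁻¹ * (coinWeight p x * coinScore p x ^ 2)) := by
    have hw := coinWeight_nonneg ⟨hp.1.le, hp.2.le⟩ x
    set w := coinWeight p x
    set s := coinScore p x
    have hplus : 0 ≤ w * ((s + c) ^ 2 / (4 * c)) := by positivity
    have hminus : 0 ≤ w * ((s - c) ^ 2 / (4 * c)) := by positivity
    have eplus : w * ((s + c) ^ 2 / (4 * c)) =
        w * s / 2 + (c / 4 * w + (4 * c)⁻¹ * (w * s ^ 2)) := by
      field_simp; ring
    have eminus : w * ((s - c) ^ 2 / (4 * c)) =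
        -(w * s / 2) + (c / 4 * w + (4 * c)⁻¹ * (w * s ^ 2)) := by
      field_simp; ring
    split_ifs <;> linarith
  rw [Finset.sum_filter]
  refine (Finset.sum_le_sum fun x _ => hterm x).trans_eq ?_
  rw [Finset.sum_add_distrib, Finset.sum_add_distrib, ← Finset.sum_div, ← Finset.mul_sum,
    ← Finset.mul_sum, h0, h1, h2, hcv]
  field_simp
  ring

lemma integral_unifIcc {a b : ℝ} (hab : a ≤ b) (F : ℝ → ℝ) :
    ∫ p, F p ∂(unifIcc a b) = (∫ p in a..b, F p) / (b - a) := by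
  rw [unifIcc, integral_smul_measure, integral_Icc_eq_integral_Ioc,
    intervalIntegral.integral_of_le hab, ENNReal.toReal_inv,
    ENNReal.toReal_ofReal (sub_nonneg.2 hab), smul_eq_mul, div_eq_inv_mul]

lemma integral_disagree_ge {m : ℕ} (hm : 1 ≤ m) (g : (Fin m → Bool) → Bool) {a b : ℝ}
    (ha : 1 / 2 ≤ a) (hab : a ≤ b) (hb : b < 1)
    (hga : acceptProb g a ≤ 1 / 4) (hgb : 3 / 4 ≤ acceptProb g b) :
    4 / 27 * √(b * (1 - b) / m) ≤
      ∫ p in a..b, 2 * acceptProb g p * (1 - acceptProb g p) := by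
  have hsub : Set.Icc a b ⊆ Set.Ioo 0 1 := fun p hp => ⟨by linarith [hp.1], by linarith [hp.2]⟩
  have hcont : ContinuousOn (acceptProb g) (Set.Icc a b) := fun p hp =>
    (hasDerivAt_acceptProb g (hsub hp)).continuousAt.continuousWithinAt
  have hbb : 0 < b * (1 - b) := mul_pos (by linarith) (by linarith)
  have hm' : (0 : ℝ) < m := by exact_mod_cast hm
  set K := √(m / (b * (1 - b)))
  have hK : 0 < K := Real.sqrt_pos.2 (div_pos hm' hbb)
  have key := intervalIntegral.sub_le_integral_of_hasDeriv_right_of_le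
    (g := fun p => acceptProb g p ^ 2 - 2 / 3 * acceptProb g p ^ 3)
    (g' := fun p => 2 * acceptProb g p * (1 - acceptProb g p) *
      ∑ x with g x = true, coinWeight p x * coinScore p x)
    (φ := fun p => 2 * acceptProb g p * (1 - acceptProb g p) * (K / 2)) hab
    ((hcont.pow 2).sub (continuousOn_const.mul (hcont.pow 3)))
    (fun p hp => by
      have h := hasDerivAt_acceptProb g (hsub (Set.Ioo_subset_Icc_self hp))
      refine HasDerivAt.hasDerivWithinAt
        (((h.fun_pow 2).sub ((h.fun_pow 3).const_mul (2 / 3))).congr_deriv ?_)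
      push_cast
      ring)
    (ContinuousOn.integrableOn_Icc (by fun_prop))
    (fun p hp => by
      have hp' := hsub (Set.Ioo_subset_Icc_self hp)
      obtain ⟨hf0, hf1⟩ := acceptProb_mem_Icc g (Set.Ioo_subset_Icc_self hp')
      refine mul_le_mul_of_nonneg_left ((deriv_acceptProb_le hm g hp').trans ?_)
        (mul_nonneg (by linarith) (by linarith))
      refine div_le_div_of_nonneg_right (Real.sqrt_le_sqrt ?_) two_pos.le
      refine div_le_div_of_nonneg_left hm'.le hbb ?_
      nlinarith [hp.1, hp.2])
  rw [intervalIntegral.integral_mul_const] at key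
  have hmono {u v : ℝ} (hu : 0 ≤ u) (huv : u ≤ v) (hv : v ≤ 1) :
      u ^ 2 - 2 / 3 * u ^ 3 ≤ v ^ 2 - 2 / 3 * v ^ 3 := by
    nlinarith [mul_nonneg (sub_nonneg.2 huv) (mul_nonneg hu (sub_nonneg.2 hv)),
      mul_nonneg (sub_nonneg.2 huv) (mul_nonneg hu (sub_nonneg.2 (huv.trans hv))),
      mul_nonneg (sub_nonneg.2 huv) (mul_nonneg (hu.trans huv) (sub_nonneg.2 hv)),
      mul_nonneg (sub_nonneg.2 huv) (sq_nonneg (v - u)), sq_nonneg (v - u)]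
  have hA := hmono (acceptProb_mem_Icc g (Set.Ioo_subset_Icc_self (hsub ⟨le_rfl, hab⟩))).1 hga
    (by norm_num)
  have hB := hmono (by norm_num) hgb
    (acceptProb_mem_Icc g (Set.Ioo_subset_Icc_self (hsub ⟨hab, le_rfl⟩))).2
  have hinv : √(b * (1 - b) / m) = K⁻¹ := by rw [← Real.sqrt_inv, inv_div]
  rw [hinv, ← div_eq_mul_inv, div_le_iff₀ hK]
  norm_num at hA hB key
  linarith

/-- if a deterministic tester `g` distinguishes `Ber(q-ε)^m` from `Ber(q)^m`
with confidence `3/4`, then for `p ~ Uniform[q-ε, q]` and `x, x'` two independent samples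
of `Ber(p)^m`, the outputs of `g` disagree with probability at least
`(4/27)·√(q(1-q)/m)/ε`. -/
theorem stmt_2 (q ε : ℝ) (hq : q ∈ Set.Ioo (1 / 2 : ℝ) 1)
    (hε : ε ∈ Set.Ioo (0 : ℝ) (q - 1 / 2)) (m : ℕ) (hm : 1 ≤ m)
    (g : (Fin m → Bool) → Bool)
    (h0 : 3 / 4 ≤ ((coinSeq m (q - ε)) {x | g x = false}).toReal)
    (h1 : 3 / 4 ≤ ((coinSeq m q) {x | g x = true}).toReal) :
    (4 / 27) * Real.sqrt (q * (1 - q) / m) / ε ≤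
      ∫ p, (((coinSeq m p).prod (coinSeq m p)) {xx | g xx.1 ≠ g xx.2}).toReal
        ∂(unifIcc (q - ε) q) := by
  obtain ⟨hq0, hq1⟩ := hq
  obtain ⟨hε0, hε1⟩ := hε
  have hmem : ∀ p ∈ Set.uIcc (q - ε) q, p ∈ Set.Icc (0 : ℝ) 1 := fun p hp => by
    rw [Set.uIcc_of_le (by linarith)] at hp
    exact ⟨by linarith [hp.1], by linarith [hp.2]⟩
  have hreject : 3 / 4 ≤ 1 - acceptProb g (q - ε) :=
    h0.trans_eq (coinSeq_real_reject g (hmem _ Set.left_mem_uIcc))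
  have haccept : 3 / 4 ≤ acceptProb g q :=
    h1.trans_eq (coinSeq_real_accept g (hmem _ Set.right_mem_uIcc))
  simp only [← Measure.real_def]
  rw [integral_unifIcc (by linarith), sub_sub_cancel,
    intervalIntegral.integral_congr fun p hp => coinSeq_prod_real_disagree g (hmem p hp)]
  exact div_le_div_of_nonneg_right
    (integral_disagree_ge hm g (by linarith) (by linarith) hq1 (by linarith) haccept) hε0.le
end

section
/- Let γ ∈ [2/3, 1), set q = (4γ - 1)/(3γ), and let ε₀ ∈ (0, (1-γ)/γ). Then 1/(1 - γq) - 1/(1 - γ(q - ε₀)) ≥ 3ε₀ / (14(1-γ)²). -/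
/-- For `γ ∈ [2/3, 1)`, `q = (4γ-1)/(3γ)` and `ε₀ ∈ (0, (1-γ)/γ)`,
`1/(1-γq) - 1/(1-γ(q-ε₀)) ≥ 3ε₀/(14(1-γ)²)`. -/
theorem stmt_6 (γ : ℝ) (hγ : γ ∈ Set.Ico (2 / 3 : ℝ) 1) (ε₀ : ℝ)
    (hε₀ : ε₀ ∈ Set.Ioo (0 : ℝ) ((1 - γ) / γ)) :
    3 * ε₀ / (14 * (1 - γ) ^ 2) ≤
      1 / (1 - γ * ((4 * γ - 1) / (3 * γ))) -
        1 / (1 - γ * ((4 * γ - 1) / (3 * γ) - ε₀)) := by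
  obtain ⟨hγ₁, hγ₂⟩ := hγ
  obtain ⟨hε, hε'⟩ := hε₀
  have hγ : 0 < γ := by linarith
  have hd : 0 < 1 - γ := by linarith
  have hγε : 0 < γ * ε₀ := mul_pos hγ hε
  have hlt : γ * ε₀ < 1 - γ := by
    rw [lt_div_iff₀ hγ] at hε'
    linarith
  have hq : 1 - γ * ((4 * γ - 1) / (3 * γ)) = 4 / 3 * (1 - γ) := by
    field_simp
    ring
  have hqε : 1 - γ * ((4 * γ - 1) / (3 * γ) - ε₀) = 4 / 3 * (1 - γ) + γ * ε₀ := by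
    linarith
  have hpos : 0 < 4 / 3 * (1 - γ) + γ * ε₀ := by positivity
  rw [hq, hqε]
  calc
    3 * ε₀ / (14 * (1 - γ) ^ 2) = (2 / 3 * ε₀) / (4 / 3 * (1 - γ) * (7 / 3 * (1 - γ))) := by
      field_simp
      norm_num
    _ ≤ (γ * ε₀) / (4 / 3 * (1 - γ) * (4 / 3 * (1 - γ) + γ * ε₀)) := by
      gcongr
      linarith
    _ = 1 / (4 / 3 * (1 - γ)) - 1 / (4 / 3 * (1 - γ) + γ * ε₀) := by
      rw [div_sub_div _ _ (by positivity) hpos.ne']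
      ring
end

section
/- Let d ≥ 1 be an integer, σ > 0, and μ, ν ∈ ℝ^d. Let P = N(μ, σ²I_d) and Q = N(ν, σ²I_d) be the corresponding product Gaussian measures on ℝ^d. Then for every Borel set E ⊆ ℝ^d, |P(E) - Q(E)| ≤ ‖μ - ν‖₂ / (2σ). -/
open MeasureTheory ProbabilityTheory Finset

/-- The total variation distance is at most half the square root of the chi-square divergence. -/
lemma abs_measureReal_withDensity_sub_le {Ω : Type*} [MeasurableSpace Ω] (P : Measure Ω)
    [IsProbabilityMeasure P] (L : Ω → ℝ) (hL0 : ∀ x, 0 ≤ L x) (hL : MemLp L 2 P)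
    (hL1 : ∫ x, L x ∂P = 1) {E : Set Ω} (hE : MeasurableSet E) :
    |(P.withDensity fun x => ENNReal.ofReal (L x)).real E - P.real E| ≤
      Real.sqrt (∫ x, L x ^ 2 ∂P - 1) / 2 := by
  have hLi : Integrable L P := hL.integrable (by norm_num)
  have hsub : MemLp (fun x => L x - 1) 2 P := hL.sub (memLp_const 1)
  have hsubi : Integrable (fun x => L x - 1) P := hsub.integrable (by norm_num)
  have hQE : (P.withDensity fun x => ENNReal.ofReal (L x)).real E = ∫ x in E, L x ∂P := by
    rw [measureReal_def, withDensity_apply _ hE,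
      ← ofReal_integral_eq_lintegral_ofReal hLi.integrableOn (ae_of_all _ hL0),
      ENNReal.toReal_ofReal (integral_nonneg hL0)]
  have hdiff : (P.withDensity fun x => ENNReal.ofReal (L x)).real E - P.real E =
      ∫ x in E, (L x - 1) ∂P := by
    rw [hQE, integral_sub hLi.integrableOn (integrable_const _).integrableOn]
    simp
  have htot : ∫ x in E, (L x - 1) ∂P + ∫ x in Eᶜ, (L x - 1) ∂P = 0 := by
    rw [integral_add_compl hE hsubi, integral_sub hLi (integrable_const _), hL1]
    simp
  have habs : ∫ x in E, |L x - 1| ∂P + ∫ x in Eᶜ, |L x - 1| ∂P = ∫ x, |L x - 1| ∂P :=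
    integral_add_compl hE hsubi.abs
  have h₁ := abs_le.1 (abs_integral_le_integral_abs (μ := P.restrict E) (f := fun x => L x - 1))
  have h₂ := abs_le.1 (abs_integral_le_integral_abs (μ := P.restrict Eᶜ) (f := fun x => L x - 1))
  have hsq : ∫ x, |L x - 1| ^ 2 ∂P = ∫ x, L x ^ 2 ∂P - 1 := by
    have : ∀ x, |L x - 1| ^ 2 = (L x ^ 2 - 2 * L x) + 1 := fun x => by rw [sq_abs]; ring
    simp_rw [this]
    have hi : Integrable (fun x => L x ^ 2 - 2 * L x) P :=
      hL.integrable_sq.sub (hLi.const_mul 2)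
    rw [integral_add hi (integrable_const _), integral_sub hL.integrable_sq (hLi.const_mul 2), integral_const_mul, hL1]
    simp
    ring
  have hvar := variance_nonneg (fun x => |L x - 1|) P
  have hsubabs : MemLp (fun x => |L x - 1|) 2 P := hsub.abs
  rw [variance_eq_sub hsubabs] at hvar
  simp only [Pi.pow_apply, hsq] at hvar
  have hmain : ∫ x, |L x - 1| ∂P ≤ Real.sqrt (∫ x, L x ^ 2 ∂P - 1) :=
    Real.le_sqrt_of_sq_le (by linarith)
  rw [hdiff, abs_le]
  constructor <;> linarith

/-- A product of measures with densities has the product of the densities as its density. -/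
lemma pi_withDensity_ofReal {ι : Type*} [Fintype ι] {X : ι → Type*}
    [∀ i, MeasurableSpace (X i)] (P : ∀ i, Measure (X i)) [∀ i, IsProbabilityMeasure (P i)]
    (L : ∀ i, X i → ℝ) (hL0 : ∀ i x, 0 ≤ L i x) (hL : ∀ i, Integrable (L i) (P i)) :
    Measure.pi (fun i => (P i).withDensity fun x => ENNReal.ofReal (L i x)) =
      (Measure.pi P).withDensity fun x => ENNReal.ofReal (∏ i, L i (x i)) := by
  have hfin : ∀ i, IsFiniteMeasure ((P i).withDensity fun x => ENNReal.ofReal (L i x)) :=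
    fun i => isFiniteMeasure_withDensity_ofReal (hL i).2
  refine Measure.pi_eq fun s hs => ?_
  rw [withDensity_apply _ (MeasurableSet.univ_pi hs), Measure.restrict_pi_pi,
    ← ofReal_integral_eq_lintegral_ofReal
      (Integrable.fintype_prod_dep fun i => (hL i).integrableOn)
      (ae_of_all _ fun x => prod_nonneg fun i _ => hL0 i _),
    integral_fintype_prod_eq_prod,
    ENNReal.ofReal_prod_of_nonneg fun i _ => integral_nonneg (hL0 i)]
  refine prod_congr rfl fun i _ => ?_
  rw [withDensity_apply _ (hs i),
    ofReal_integral_eq_lintegral_ofReal (hL i).integrableOn (ae_of_all _ (hL0 i))]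

/-- The likelihood ratio of `N(b, v)` with respect to `N(a, v)`. -/
noncomputable def gaussianRatio (a b : ℝ) (v : NNReal) (x : ℝ) : ℝ :=
  Real.exp ((b - a) / v * x) * Real.exp (-(b ^ 2 - a ^ 2) / (2 * v))

lemma gaussianRatio_nonneg (a b : ℝ) (v : NNReal) (x : ℝ) : 0 ≤ gaussianRatio a b v x := by
  unfold gaussianRatio; positivity

lemma gaussianRatio_sq (a b : ℝ) (v : NNReal) (x : ℝ) :
    gaussianRatio a b v x ^ 2 =
      Real.exp (2 * (b - a) / v * x) * Real.exp (-(b ^ 2 - a ^ 2) / v) := by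
  unfold gaussianRatio
  rw [mul_pow, ← Real.exp_nat_mul, ← Real.exp_nat_mul]
  congr 2 <;> push_cast <;> field_simp

lemma integrable_gaussianRatio (a b : ℝ) (v : NNReal) :
    Integrable (gaussianRatio a b v) (gaussianReal a v) :=
  (integrable_exp_mul_gaussianReal _).mul_const _

lemma integrable_gaussianRatio_sq (a b : ℝ) (v : NNReal) :
    Integrable (fun x => gaussianRatio a b v x ^ 2) (gaussianReal a v) := by
  simp_rw [gaussianRatio_sq]
  exact (integrable_exp_mul_gaussianReal _).mul_const _

lemma integral_exp_mul_gaussianReal (a t : ℝ) (v : NNReal) :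
    ∫ x, Real.exp (t * x) ∂gaussianReal a v = Real.exp (a * t + v * t ^ 2 / 2) :=
  congrFun (mgf_fun_id_gaussianReal (μ := a) (v := v)) t

lemma integral_gaussianRatio (a b : ℝ) {v : NNReal} (hv : v ≠ 0) :
    ∫ x, gaussianRatio a b v x ∂gaussianReal a v = 1 := by
  have hv' : (v : ℝ) ≠ 0 := by exact_mod_cast hv
  unfold gaussianRatio
  rw [integral_mul_const, integral_exp_mul_gaussianReal, ← Real.exp_add, Real.exp_eq_one_iff]
  field_simp
  ring

lemma integral_gaussianRatio_sq (a b : ℝ) {v : NNReal} (hv : v ≠ 0) :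
    ∫ x, gaussianRatio a b v x ^ 2 ∂gaussianReal a v = Real.exp ((b - a) ^ 2 / v) := by
  have hv' : (v : ℝ) ≠ 0 := by exact_mod_cast hv
  simp_rw [gaussianRatio_sq]
  rw [integral_mul_const, integral_exp_mul_gaussianReal, ← Real.exp_add]
  congr 1
  field_simp
  ring

lemma gaussianReal_eq_withDensity_gaussianRatio (a b : ℝ) {v : NNReal} (hv : v ≠ 0) :
    gaussianReal b v =
      (gaussianReal a v).withDensity fun x => ENNReal.ofReal (gaussianRatio a b v x) := by
  have hv' : (v : ℝ) ≠ 0 := by exact_mod_cast hv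
  have hm : Measurable fun x => ENNReal.ofReal (gaussianRatio a b v x) := by
    unfold gaussianRatio; fun_prop
  rw [gaussianReal_of_var_ne_zero _ hv, gaussianReal_of_var_ne_zero _ hv,
    ← withDensity_mul _ (measurable_gaussianPDF _ _) hm]
  congr 1
  ext x
  rw [Pi.mul_apply, gaussianPDF, gaussianPDF, ← ENNReal.ofReal_mul (gaussianPDFReal_nonneg _ _ _),
    gaussianPDFReal, gaussianPDFReal, gaussianRatio, ← Real.exp_add, mul_assoc (√_)⁻¹, ← Real.exp_add]
  congr 3
  field_simp
  ring

/-- The chi-square bound for the total variation distance of two product Gaussian measures. -/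
lemma abs_pi_gaussianReal_sub_le {ι : Type*} [Fintype ι] (a b : ι → ℝ) {v : NNReal} (hv : v ≠ 0)
    {E : Set (ι → ℝ)} (hE : MeasurableSet E) :
    |(Measure.pi fun i => gaussianReal (b i) v).real E -
        (Measure.pi fun i => gaussianReal (a i) v).real E| ≤
      Real.sqrt (Real.exp ((∑ i, (b i - a i) ^ 2) / v) - 1) / 2 := by
  have hQ : (Measure.pi fun i => gaussianReal (b i) v) =
      (Measure.pi fun i => gaussianReal (a i) v).withDensity
        fun x => ENNReal.ofReal (∏ i, gaussianRatio (a i) (b i) v (x i)) := by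
    rw [← pi_withDensity_ofReal (fun i => gaussianReal (a i) v)
      (fun i => gaussianRatio (a i) (b i) v) (fun i => gaussianRatio_nonneg _ _ _)
      (fun i => integrable_gaussianRatio _ _ _)]
    simp_rw [← gaussianReal_eq_withDensity_gaussianRatio _ _ hv]
  have hint := Integrable.fintype_prod_dep fun i => integrable_gaussianRatio (a i) (b i) v
  have hLp : MemLp (fun x : ι → ℝ => ∏ i, gaussianRatio (a i) (b i) v (x i)) 2
      (Measure.pi fun i => gaussianReal (a i) v) := by
    rw [memLp_two_iff_integrable_sq hint.1]
    simp_rw [← prod_pow]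
    exact Integrable.fintype_prod_dep fun i => integrable_gaussianRatio_sq (a i) (b i) v
  have hsq : ∫ x : ι → ℝ, (∏ i, gaussianRatio (a i) (b i) v (x i)) ^ 2
      ∂(Measure.pi fun i => gaussianReal (a i) v) =
        Real.exp ((∑ i, (b i - a i) ^ 2) / v) := by
    simp_rw [← prod_pow]
    rw [integral_fintype_prod_eq_prod (fun i x => gaussianRatio (a i) (b i) v x ^ 2)]
    simp_rw [integral_gaussianRatio_sq _ _ hv]
    rw [← Real.exp_sum, sum_div]
  rw [hQ, ← hsq]
  refine abs_measureReal_withDensity_sub_le _ _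
    (fun x => prod_nonneg fun i _ => gaussianRatio_nonneg _ _ _ _) hLp ?_ hE
  rw [integral_fintype_prod_eq_prod (fun i => gaussianRatio (a i) (b i) v)]
  simp_rw [integral_gaussianRatio _ _ hv, prod_const_one]

lemma nat_mul_sqrt_exp_div_sq_sub_one_le {S : ℝ} (hS : 0 ≤ S) {n : ℕ} (hn : 0 < n)
    (hSn : S ≤ n) : n * Real.sqrt (Real.exp (S / n ^ 2) - 1) ≤ Real.sqrt (S + S ^ 2 / n) := by
  have hn1 : (1 : ℝ) ≤ n := by exact_mod_cast hn
  have hx0 : 0 ≤ S / (n : ℝ) ^ 2 := by positivity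
  have hx1 : S / (n : ℝ) ^ 2 ≤ 1 := by
    rw [div_le_one (by positivity)]; nlinarith
  have hexp := (abs_le.1 (Real.abs_exp_sub_one_sub_id_le (abs_le.2 ⟨by linarith, hx1⟩))).2
  refine Real.le_sqrt_of_sq_le ?_
  rw [mul_pow, Real.sq_sqrt (by linarith [Real.add_one_le_exp (S / (n : ℝ) ^ 2)])]
  calc (n : ℝ) ^ 2 * (Real.exp (S / n ^ 2) - 1)
      ≤ (n : ℝ) ^ 2 * (S / n ^ 2 + (S / n ^ 2) ^ 2) := by gcongr; linarith
    _ = S + S ^ 2 / n ^ 2 := by field_simp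
    _ ≤ S + S ^ 2 / n := by gcongr; nlinarith

/-- Splitting the segment from `a` to `b` into `n` equal steps and applying the chi-square bound
to each step. -/
lemma abs_pi_gaussianReal_sub_le_nat_mul {ι : Type*} [Fintype ι] (a b : ι → ℝ) {v : NNReal}
    (hv : v ≠ 0) {E : Set (ι → ℝ)} (hE : MeasurableSet E) {n : ℕ} (hn : 0 < n) :
    |(Measure.pi fun i => gaussianReal (a i) v).real E -
        (Measure.pi fun i => gaussianReal (b i) v).real E| ≤
      n * Real.sqrt (Real.exp ((∑ i, (a i - b i) ^ 2) / v / n ^ 2) - 1) / 2 := by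
  have hn' : (n : ℝ) ≠ 0 := by positivity
  let F : ℕ → ℝ := fun k =>
    (Measure.pi fun i => gaussianReal (a i + k / n * (b i - a i)) v).real E
  have hstep : ∀ {k : ℕ}, k < n → dist (F k) (F (k + 1)) ≤
      Real.sqrt (Real.exp ((∑ i, (a i - b i) ^ 2) / v / n ^ 2) - 1) / 2 := by
    intro k _
    rw [dist_comm, Real.dist_eq]
    refine (abs_pi_gaussianReal_sub_le _ _ hv hE).trans_eq ?_
    rw [div_right_comm _ (v : ℝ), sum_div _ _ ((n : ℝ) ^ 2)]
    congr! 6 with i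
    push_cast
    field_simp
    ring
  have h := dist_le_range_sum_of_dist_le n hstep
  simpa [F, Real.dist_eq, hn', mul_div_assoc] using h

/-- For product Gaussian measures `P = N(μ, σ²I_d)` and `Q = N(ν, σ²I_d)`
on `ℝ^d` and every Borel set `E`, `|P(E) - Q(E)| ≤ ‖μ - ν‖₂ / (2σ)`. -/
theorem stmt_8 (d : ℕ) (hd : 1 ≤ d) (σ : ℝ) (hσ : 0 < σ) (μ ν : Fin d → ℝ)
    (E : Set (Fin d → ℝ)) (hE : MeasurableSet E) :
    |((Measure.pi fun i => gaussianReal (μ i) ((σ ^ 2).toNNReal)) E).toReal -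
        ((Measure.pi fun i => gaussianReal (ν i) ((σ ^ 2).toNNReal)) E).toReal| ≤
      Real.sqrt (∑ i, (μ i - ν i) ^ 2) / (2 * σ) := by
  have hv : (σ ^ 2).toNNReal ≠ 0 := (Real.toNNReal_pos.2 (by positivity)).ne'
  set S : ℝ := (∑ i, (μ i - ν i) ^ 2) / σ ^ 2 with hS
  have hS0 : 0 ≤ S := div_nonneg (sum_nonneg fun i _ => sq_nonneg _) (sq_nonneg _)
  have hlim : Filter.Tendsto (fun n : ℕ => Real.sqrt (S + S ^ 2 / n) / 2) Filter.atTop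
      (nhds (Real.sqrt S / 2)) := by
    have h := (tendsto_const_div_atTop_nhds_zero_nat (S ^ 2)).const_add S
    rw [add_zero] at h
    exact h.sqrt.div_const 2
  have hval : Real.sqrt (∑ i, (μ i - ν i) ^ 2) / (2 * σ) = Real.sqrt S / 2 := by
    rw [hS, Real.sqrt_div' _ (sq_nonneg σ), Real.sqrt_sq hσ.le, div_div, mul_comm]
  rw [hval]
  refine ge_of_tendsto hlim ?_
  filter_upwards [Filter.eventually_ge_atTop (max 1 ⌈S⌉₊)] with n hn
  have hn0 : 0 < n := (le_max_left 1 _).trans hn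
  have hSn : S ≤ n := Nat.ceil_le.1 ((le_max_right 1 _).trans hn)
  have h := abs_pi_gaussianReal_sub_le_nat_mul μ ν hv hE hn0
  rw [Real.coe_toNNReal _ (sq_nonneg σ), ← hS] at h
  exact h.trans (by gcongr; exact nat_mul_sqrt_exp_div_sq_sub_one_le hS0 hn0 hSn)
end

section
/- Let S and A be nonempty finite sets, γ ∈ (0,1), r : S × A → [0,1], and P : S × A → (probability vectors on S), i.e. P(s'|s,a) ≥ 0 and Σ_{s'} P(s'|s,a) = 1 for all (s,a). Suppose Q* : S × A → ℝ and V* : S → ℝ satisfy the Bellman optimality equations V*(s) = max_{a} Q*(s,a) and Q*(s,a) = r(s,a) + γ Σ_{s'} P(s'|s,a) V*(s') for all s ∈ S, a ∈ A. Let ε₁, ε₂ ∈ (0,1), and let Q̂ : S × A → ℝ satisfy |Q̂(s,a) − Q*(s,a)| ≤ ε₁ for all (s,a). Set λ = log(|A|)/ε₂ and define the randomized policy π̂(s,a) = exp(λ Q̂(s,a)) / Σ_{a'} exp(λ Q̂(s,a')). Suppose V^π̂ : S → ℝ satisfies the policy Bellman equation V^π̂(s) = Σ_a π̂(s,a) ·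 (r(s,a) + γ Σ_{s'} P(s'|s,a) V^π̂(s')) for all s. Then max_{s ∈ S} |V*(s) − V^π̂(s)| ≤ (2ε₁ + ε₂)/(1 − γ). -/
open Finset

/-- The mean of `y` under its own Gibbs weights is within `log |A|` of every value of `y`. -/
lemma sub_log_card_le_gibbs_mean {A : Type*} [Fintype A] [Nonempty A] (y : A → ℝ) (b : A) :
    y b - Real.log (Fintype.card A) ≤
      ∑ a, Real.exp (y a) / (∑ a', Real.exp (y a')) * y a := by
  set Z := ∑ a', Real.exp (y a') with hZ
  have hZ0 : 0 < Z := Finset.sum_pos (fun a _ => Real.exp_pos _) Finset.univ_nonempty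
  have hn : (0 : ℝ) < Fintype.card A := by exact_mod_cast Fintype.card_pos
  have hsum : ∑ a, Real.exp (y a) / Z = 1 := by
    rw [← Finset.sum_div, ← hZ, div_self hZ0.ne']
  have hbZ : y b ≤ Real.log Z := by
    rw [Real.le_log_iff_exp_le hZ0]
    exact Finset.single_le_sum (f := fun a => Real.exp (y a))
      (fun a _ => (Real.exp_pos _).le) (Finset.mem_univ b)
  have hterm : ∀ a, Real.exp (y a) / Z * (Real.log Z - Real.log (Fintype.card A) - y a) ≤
      1 / (Fintype.card A : ℝ) - Real.exp (y a) / Z := by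
    intro a
    have he := Real.exp_pos (y a)
    have h := Real.log_le_sub_one_of_pos
      (show 0 < Z / (Fintype.card A) / Real.exp (y a) by positivity)
    rw [Real.log_div (by positivity) he.ne', Real.log_div hZ0.ne' hn.ne', Real.log_exp] at h
    refine (mul_le_mul_of_nonneg_left h (by positivity)).trans_eq ?_
    field_simp
  have h := Finset.sum_le_sum fun a (_ : a ∈ Finset.univ) => hterm a
  simp only [mul_sub, Finset.sum_sub_distrib, ← Finset.sum_mul, hsum, Finset.sum_const,
    Finset.card_univ, nsmul_eq_mul, mul_one_div_cancel hn.ne'] at h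
  linarith

/-- The soft-max with inverse temperature `log |A| / ε` loses at most `ε` against any action. -/
lemma sub_le_softmax_mean {A : Type*} [Fintype A] [Nonempty A] {ε : ℝ} (hε : 0 < ε)
    (x : A → ℝ) (b : A) :
    x b - ε ≤ ∑ a, Real.exp ((Real.log (Fintype.card A) / ε) * x a) /
      (∑ a', Real.exp ((Real.log (Fintype.card A) / ε) * x a')) * x a := by
  rcases subsingleton_or_nontrivial A with hA | hA
  · have : Unique A := ⟨⟨b⟩, fun a => Subsingleton.elim a b⟩
    simp [Subsingleton.elim b default, hε.le]
  · have hlog : 0 < Real.log (Fintype.card A) :=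
      Real.log_pos (by exact_mod_cast Fintype.one_lt_card)
    have hl : 0 < Real.log (Fintype.card A) / ε := by positivity
    have h := sub_log_card_le_gibbs_mean (fun a => (Real.log (Fintype.card A) / ε) * x a) b
    simp only [mul_left_comm _ (Real.log (Fintype.card A) / ε), ← Finset.mul_sum] at h
    refine le_of_mul_le_mul_left ?_ hl
    rw [mul_sub, div_mul_cancel₀ _ hε.ne']
    exact h

lemma abs_sum_mul_le_of_sum_eq_one {ι : Type*} [Fintype ι] {p f : ι → ℝ} {D : ℝ}
    (hp0 : ∀ i, 0 ≤ p i) (hp1 : ∑ i, p i = 1) (hf : ∀ i, |f i| ≤ D) :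
    |∑ i, p i * f i| ≤ D :=
  calc |∑ i, p i * f i| ≤ ∑ i, |p i * f i| := Finset.abs_sum_le_sum_abs _ _
    _ ≤ ∑ i, p i * D := Finset.sum_le_sum fun i _ => by
        rw [abs_mul, abs_of_nonneg (hp0 i)]
        exact mul_le_mul_of_nonneg_left (hf i) (hp0 i)
    _ = D := by rw [← Finset.sum_mul, hp1, one_mul]

lemma abs_le_div_one_sub_of_contraction {S : Type*} [Finite S] [Nonempty S] {f : S → ℝ}
    {c γ : ℝ} (hγ : γ < 1) (h : ∀ D, (∀ s, |f s| ≤ D) → ∀ s, |f s| ≤ c + γ * D) (s : S) :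
    |f s| ≤ c / (1 - γ) := by
  obtain ⟨t, ht⟩ := Finite.exists_max fun s => |f s|
  refine (ht s).trans ?_
  rw [le_div_iff₀ (by linarith)]
  linarith [h _ ht t]

/-- suboptimality of the exponential soft-max policy derived from an
`ε₁`-accurate `Q`-function in a discounted MDP: `‖V* - V^π̂‖_∞ ≤ (2ε₁ + ε₂)/(1-γ)`. -/
theorem stmt_13 {S A : Type*} [Fintype S] [Nonempty S] [Fintype A] [Nonempty A]
    (γ : ℝ) (hγ : γ ∈ Set.Ioo (0 : ℝ) 1)
    (r : S → A → ℝ) (hr : ∀ s a, r s a ∈ Set.Icc (0 : ℝ) 1)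
    (P : S → A → S → ℝ) (hP0 : ∀ s a s', 0 ≤ P s a s') (hP1 : ∀ s a, ∑ s', P s a s' = 1)
    (Qstar : S → A → ℝ) (Vstar : S → ℝ)
    (hV : ∀ s, Vstar s = Finset.univ.sup' Finset.univ_nonempty (Qstar s))
    (hQ : ∀ s a, Qstar s a = r s a + γ * ∑ s', P s a s' * Vstar s')
    (ε₁ ε₂ : ℝ) (hε₁ : ε₁ ∈ Set.Ioo (0 : ℝ) 1) (hε₂ : ε₂ ∈ Set.Ioo (0 : ℝ) 1)
    (Qhat : S → A → ℝ) (hQhat : ∀ s a, |Qhat s a - Qstar s a| ≤ ε₁)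
    (π : S → A → ℝ)
    (hπ : ∀ s a, π s a =
      Real.exp ((Real.log (Fintype.card A) / ε₂) * Qhat s a) /
        ∑ a', Real.exp ((Real.log (Fintype.card A) / ε₂) * Qhat s a'))
    (Vπ : S → ℝ)
    (hVπ : ∀ s, Vπ s = ∑ a, π s a * (r s a + γ * ∑ s', P s a s' * Vπ s')) :
    ∀ s, |Vstar s - Vπ s| ≤ (2 * ε₁ + ε₂) / (1 - γ) := by
  have hZ0 : ∀ s, 0 < ∑ a', Real.exp ((Real.log (Fintype.card A) / ε₂) * Qhat s a') :=
    fun s => Finset.sum_pos (fun a _ => Real.exp_pos _) Finset.univ_nonempty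
  have hπ0 : ∀ s a, 0 ≤ π s a := fun s a => by
    rw [hπ]
    exact div_nonneg (Real.exp_pos _).le (hZ0 s).le
  have hπ1 : ∀ s, ∑ a, π s a = 1 := fun s => by
    simp only [hπ]
    rw [← Finset.sum_div, div_self (hZ0 s).ne']
  have hgreedy : ∀ s, |Vstar s - ∑ a, π s a * Qstar s a| ≤ 2 * ε₁ + ε₂ := by
    intro s
    obtain ⟨b, -, hb⟩ := Finset.exists_mem_eq_sup' Finset.univ_nonempty (Qstar s)
    have hsoft := sub_le_softmax_mean hε₂.1 (Qhat s) b
    simp only [← hπ] at hsoft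
    have herr := abs_le.mp (abs_sum_mul_le_of_sum_eq_one (hπ0 s) (hπ1 s) (hQhat s))
    simp only [mul_sub, Finset.sum_sub_distrib] at herr
    have hle : ∑ a, π s a * Qstar s a ≤ Vstar s :=
      calc ∑ a, π s a * Qstar s a ≤ ∑ a, π s a * Vstar s := Finset.sum_le_sum fun a _ =>
            mul_le_mul_of_nonneg_left (hV s ▸ Finset.le_sup' (Qstar s) (Finset.mem_univ a))
              (hπ0 s a)
        _ = Vstar s := by rw [← Finset.sum_mul, hπ1, one_mul]
    rw [abs_of_nonneg (by linarith), hV, hb]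
    linarith [abs_le.mp (hQhat s b)]
  refine abs_le_div_one_sub_of_contraction (f := fun s => Vstar s - Vπ s) hγ.2 fun D hD s => ?_
  have hsplit : Vstar s - Vπ s = (Vstar s - ∑ a, π s a * Qstar s a) +
      γ * ∑ a, π s a * ∑ s', P s a s' * (Vstar s' - Vπ s') := by
    rw [hVπ s]
    simp only [hQ, mul_sub, mul_add, Finset.sum_sub_distrib, Finset.sum_add_distrib,
      mul_left_comm _ γ, ← Finset.mul_sum]
    ring
  have hnext := abs_sum_mul_le_of_sum_eq_one (hπ0 s) (hπ1 s) fun a =>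
    abs_sum_mul_le_of_sum_eq_one (hP0 s a) (hP1 s a) hD
  simp only [hsplit]
  refine (abs_add_le _ _).trans (add_le_add (hgreedy s) ?_)
  rw [abs_mul, abs_of_pos hγ.1]
  exact mul_le_mul_of_nonneg_left hnext hγ.1.le
end
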